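/- arXiv:2504.00760 — 2 statements merged into one kernel-verified Lean document; each statement's English description precedes it below -/
import Mathlib

section
/- Let G be a 4-connected graph. (1) If G has no tetra-separation, then G is quasi-5-connected. (2) If G is quasi-5-connected and has at least 8 vertices, then G has no tetra-separation. -/
open Set

namespace Paper

variable {V : Type*}

/-- The set of edges of `G` with one endvertex in `A \ B` and the other in `B \ A`. -/
def sepEdges (G : SimpleGraph V) (A B : Set V) : Set (Sym2 V) :=
  {e | e ∈ G.edgeSet ∧ ∃ a b : V, e = s(a, b) ∧ a ∈ A \ B ∧ b ∈ B \ A}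

/-- The order of the mixed-separation `(A, B)`: the number of vertices of `A ∩ B`
plus the number of edges between `A \ B` and `B \ A`. -/
noncomputable def sepOrder (G : SimpleGraph V) (A B : Set V) : ℕ∞ :=
  (A ∩ B).encard + (sepEdges G A B).encard

/-- A mixed-separation⁺: a pair of vertex sets covering the whole graph. -/
def IsMixedSepPlus (A B : Set V) : Prop := A ∪ B = Set.univ

/-- A (proper) mixed-separation. -/
def IsMixedSep (A B : Set V) : Prop :=
  A ∪ B = Set.univ ∧ (A \ B).Nonempty ∧ (B \ A).Nonempty

/-- `G` is `k`-connected: it has more than `k` vertices and deleting fewer than `k`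
vertices keeps it connected. -/
def KConnected (G : SimpleGraph V) (k : ℕ) : Prop :=
  (k : ℕ∞) < (Set.univ : Set V).encard ∧
    ∀ X : Set V, X.encard < (k : ℕ∞) → (G.induce (Xᶜ : Set V)).Connected

/-- Every vertex of `A ∩ B` has at least two neighbours in `A \ B`
and at least two neighbours in `B \ A`. -/
def DegreeCondition (G : SimpleGraph V) (A B : Set V) : Prop :=
  ∀ v ∈ A ∩ B,
    2 ≤ (G.neighborSet v ∩ (A \ B)).encard ∧ 2 ≤ (G.neighborSet v ∩ (B \ A)).encard

/-- No two edges in the separator of `(A,B)` share an endvertex. -/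
def MatchingCondition (G : SimpleGraph V) (A B : Set V) : Prop :=
  ∀ e ∈ sepEdges G A B, ∀ f ∈ sepEdges G A B, e ≠ f → ∀ v : V, v ∈ e → v ∉ f

/-- A tetra-separation. -/
def IsTetraSep (G : SimpleGraph V) (A B : Set V) : Prop :=
  IsMixedSep A B ∧ sepOrder G A B = 4 ∧ DegreeCondition G A B ∧ MatchingCondition G A B

/-- `(A,B) ≤ (C,D)`. -/
def LeSep (A B C D : Set V) : Prop := A ⊆ C ∧ D ⊆ B

/-- `(A,B)` and `(C,D)` are nested. -/
def Nested (A B C D : Set V) : Prop :=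
  LeSep A B C D ∨ LeSep A B D C ∨ LeSep B A C D ∨ LeSep B A D C

/-- `(A,B)` and `(C,D)` cross. -/
def Crosses (A B C D : Set V) : Prop := ¬ Nested A B C D

/-- The corner for the sides `A` and `C` of the pair `(A,B)`, `(C,D)`. -/
def corner (A B C D : Set V) : Set V := (A \ B) ∩ (C \ D)

/-- The vertex-centre of the crossing-diagram of `(A,B)` and `(C,D)`. -/
def vertexCentre (A B C D : Set V) : Set V := A ∩ B ∩ C ∩ D

/-- An edge is diagonal if its endvertices lie in opposite corners. -/
def IsDiagonal (G : SimpleGraph V) (A B C D : Set V) (e : Sym2 V) : Prop :=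
  e ∈ G.edgeSet ∧ ∃ a b : V, e = s(a, b) ∧
    ((a ∈ corner A B C D ∧ b ∈ corner B A D C) ∨
     (a ∈ corner A B D C ∧ b ∈ corner B A C D))

/-- The `C`-link of the crossing diagram of `(A,B)` and `(C,D)`: all non-diagonal
edges of `S(A,B)` with an endvertex in the corner for `AC` or for `BC`, together with
all vertices of `(C \ D) ∩ S(A,B)`.  (The `D`-link is `link G A B D C`, the `A`-link
is `link G C D A B`, the `B`-link is `link G C D B A`.) -/
def link (G : SimpleGraph V) (A B C D : Set V) : Set (V ⊕ Sym2 V) :=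
  Sum.inl '' ((C \ D) ∩ (A ∩ B)) ∪
    Sum.inr '' {e | e ∈ sepEdges G A B ∧ ¬ IsDiagonal G A B C D e ∧
      ∃ v : V, v ∈ e ∧ (v ∈ corner A B C D ∨ v ∈ corner B A C D)}

/-- The centre: the vertex-centre together with all diagonal edges. -/
def centre (G : SimpleGraph V) (A B C D : Set V) : Set (V ⊕ Sym2 V) :=
  Sum.inl '' vertexCentre A B C D ∪ Sum.inr '' {e | IsDiagonal G A B C D e}

/-- The corner-separator `L(A,C)`: the union of the `A`-link, the `C`-link, the
vertex-centre and the diagonal edges with an endvertex in the corner for `AC`. -/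
def cornerSep (G : SimpleGraph V) (A B C D : Set V) : Set (V ⊕ Sym2 V) :=
  link G C D A B ∪ link G A B C D ∪ Sum.inl '' vertexCentre A B C D ∪
    Sum.inr '' {e | IsDiagonal G A B C D e ∧ ∃ v : V, v ∈ e ∧ v ∈ corner A B C D}

/-- An edge is jumping if its endvertices lie in opposite links. -/
def IsJumping (G : SimpleGraph V) (A B C D : Set V) (e : Sym2 V) : Prop :=
  e ∈ G.edgeSet ∧ ∃ a b : V, e = s(a, b) ∧
    ((Sum.inl a ∈ link G C D A B ∧ Sum.inl b ∈ link G C D B A) ∨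
     (Sum.inl a ∈ link G A B C D ∧ Sum.inl b ∈ link G A B D C))

/-- An edge dangles from `fromLink` through `throughLink` if it has an endvertex
that is a vertex of `fromLink` and the edge itself is an element of `throughLink`. -/
def DanglesFromThrough (G : SimpleGraph V) (fromLink throughLink : Set (V ⊕ Sym2 V))
    (e : Sym2 V) : Prop :=
  e ∈ G.edgeSet ∧ (∃ v : V, v ∈ e ∧ Sum.inl v ∈ fromLink) ∧ Sum.inr e ∈ throughLink

/-- The corner for `A` and `C` is potter. -/
def Potter (G : SimpleGraph V) (A B C D : Set V) : Prop :=
  corner A B C D = ∅ ∧ (link G C D A B).encard = 2 ∧ (link G A B C D).encard = 2 ∧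
    ∃ u₁ u₂ u₃ u₄ : V, G.Adj u₁ u₂ ∧ G.Adj u₂ u₃ ∧ G.Adj u₃ u₄ ∧
      List.Nodup [u₁, u₂, u₃, u₄] ∧
      Sum.inl u₂ ∈ link G A B C D ∧ Sum.inr (s(u₁, u₂)) ∈ link G C D A B ∧
      Sum.inl u₃ ∈ link G C D A B ∧ Sum.inr (s(u₃, u₄)) ∈ link G A B C D

/-- All four links have size two and the centre is empty. -/
def LinksTwoCentreEmpty (G : SimpleGraph V) (A B C D : Set V) : Prop :=
  (link G C D A B).encard = 2 ∧ (link G C D B A).encard = 2 ∧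
    (link G A B C D).encard = 2 ∧ (link G A B D C).encard = 2 ∧
    centre G A B C D = ∅

/-- `(A,B)` is half-connected. -/
def HalfConnected (G : SimpleGraph V) (A B : Set V) : Prop :=
  (G.induce (A \ B)).Connected ∨ (G.induce (B \ A)).Connected

/-- First component of the left-reduction of `(A,B)`: delete from `A` the vertices of
`A ∩ B` with at most one neighbour in `A \ B`.  (The left-reduction of `(A,B)` is
`(leftRed G A B, B)`; the right-reduction is `(A, leftRed G B A)`.) -/
def leftRed (G : SimpleGraph V) (A B : Set V) : Set V :=
  A \ {v | v ∈ A ∩ B ∧ (G.neighborSet v ∩ (A \ B)).encard ≤ 1}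

/-- The separator of `(A,B)` as a set of vertices and edges. -/
def sepElems (G : SimpleGraph V) (A B : Set V) : Set (V ⊕ Sym2 V) :=
  Sum.inl '' (A ∩ B) ∪ Sum.inr '' sepEdges G A B

/-- `x̂`: the endvertices of an element of the separator. -/
def hat : V ⊕ Sym2 V → Set V
  | Sum.inl v => {v}
  | Sum.inr e => {w | w ∈ e}

/-- `X̂` for a set `X` of vertices and edges. -/
def hatSet (π : Set (V ⊕ Sym2 V)) : Set V := ⋃ x ∈ π, hat x

/-- Inner vertices of a walk. -/
def innerVerts (G : SimpleGraph V) {u v : V} (p : G.Walk u v) : Set V :=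
  {w | w ∈ p.support ∧ w ≠ u ∧ w ≠ v}

/-- An `X`–`Y` path: a path starting in `X`, ending in `Y`, with no other
vertex in `X ∪ Y`. -/
def IsXYPath (G : SimpleGraph V) (X Y : Set V) {u v : V} (p : G.Walk u v) : Prop :=
  p.IsPath ∧ u ∈ X ∧ v ∈ Y ∧ ∀ w ∈ p.support, w ∈ X ∪ Y → w = u ∨ w = v

/-- A walk avoids a vertex (it is not on the walk) or an edge (it is not used). -/
def WalkAvoids (G : SimpleGraph V) {u v : V} (p : G.Walk u v) (x : V ⊕ Sym2 V) : Prop :=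
  Sum.elim (fun w => w ∉ p.support) (fun e => e ∉ p.edges) x

/-- There are `n` pairwise independent `X`–`Y` paths in `G`
(no path contains an inner vertex of another). -/
def HasIndepPaths (G : SimpleGraph V) (X Y : Set V) (n : ℕ) : Prop :=
  ∃ (a b : Fin n → V) (p : ∀ i, G.Walk (a i) (b i)),
    (∀ i, IsXYPath G X Y (p i)) ∧
      ∀ i j, i ≠ j → ∀ w ∈ innerVerts G (p i), w ∉ (p j).support

/-- Maximum number of pairwise independent `X`–`Y` paths in `G`. -/
noncomputable def maxIndepPaths (G : SimpleGraph V) (X Y : Set V) : ℕ∞ :=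
  sSup {n : ℕ∞ | ∃ m : ℕ, n = (m : ℕ∞) ∧ HasIndepPaths G X Y m}

/-- `(A,B)` strongly separates `X` and `Y`. -/
def StronglySeparates (A B X Y : Set V) : Prop := X ⊆ A \ B ∧ Y ⊆ B \ A

/-- Minimum order of a mixed-separation of `G` strongly separating `X` and `Y`. -/
noncomputable def minSepOrder (G : SimpleGraph V) (X Y : Set V) : ℕ∞ :=
  sInf {n : ℕ∞ | ∃ A B : Set V,
    IsMixedSep A B ∧ StronglySeparates A B X Y ∧ sepOrder G A B = n}

/-- A `k`-separation: a mixed-separation of order `k` whose separator has no edges. -/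
def IsVertexSep (G : SimpleGraph V) (A B : Set V) (k : ℕ) : Prop :=
  IsMixedSep A B ∧ sepEdges G A B = ∅ ∧ sepOrder G A B = (k : ℕ∞)

/-- `G` is quasi-`k`-connected: `(k-1)`-connected and every `(k-1)`-separation has a
side whose proper part is a single vertex. -/
def QuasiConnected (G : SimpleGraph V) (k : ℕ) : Prop :=
  KConnected G (k - 1) ∧
    ∀ A B : Set V, IsVertexSep G A B (k - 1) →
      (A \ B).encard = 1 ∨ (B \ A).encard = 1

/-- `{x₁,x₂}` is 3-linked around the separator `{x₁,x₂,x₃,x₄}`. -/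
def ThreeLinkedAround (G : SimpleGraph V) (x₁ x₂ x₃ x₄ : V ⊕ Sym2 V) : Prop :=
  (∃ e : Sym2 V, x₃ = Sum.inr e) ∨ (∃ e : Sym2 V, x₄ = Sum.inr e) ∨
    (((∃ v : V, x₁ = Sum.inl v) ∨ (∃ v : V, x₂ = Sum.inl v)) ∧
      ∃ a b : V, G.Adj a b ∧ a ∈ hat x₁ ∧ b ∈ hat x₂) ∨
    (∃ (a b : Fin 3 → V) (p : ∀ i, G.Walk (a i) (b i)),
      (∀ i, IsXYPath G (hat x₁) (hat x₂) (p i) ∧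
        WalkAvoids G (p i) x₃ ∧ WalkAvoids G (p i) x₄) ∧
      ∀ i j, i ≠ j → ∀ w ∈ innerVerts G (p i), w ∉ (p j).support)

/-- `G` is 4-angry: 4-connected and every tetra-separation is crossed. -/
def FourAngry (G : SimpleGraph V) : Prop :=
  KConnected G 4 ∧
    ∀ A B : Set V, IsTetraSep G A B → ∃ C D : Set V, IsTetraSep G C D ∧ Crosses A B C D

/-- `G` is a sprinkled `K₄,ₘ`: a set `X` of four vertices, whose complement has
exactly `m` elements, is independent and completely joined to `X`
(edges inside `X` arbitrary). -/
def IsSprinkledK4m (G : SimpleGraph V) (m : ℕ∞) : Prop :=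
  ∃ X : Set V, X.encard = 4 ∧ (Xᶜ : Set V).encard = m ∧
    (∀ a b : V, a ∉ X → b ∉ X → ¬ G.Adj a b) ∧
    ∀ a : V, a ∉ X → ∀ x ∈ X, G.Adj a x

lemma KConnected.exists_adj_of_compl_eq_union {G : SimpleGraph V} {k : ℕ} (hG : KConnected G k)
    {Z P Q : Set V} (hZ : Z.encard < k) (hP : P.Nonempty) (hQ : Q.Nonempty)
    (hPQ : Disjoint P Q) (hU : Zᶜ = P ∪ Q) : ∃ u ∈ P, ∃ v ∈ Q, G.Adj u v := by
  obtain ⟨p, hp⟩ := hP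
  obtain ⟨q, hq⟩ := hQ
  have hpZ : p ∈ Zᶜ := hU ▸ Or.inl hp
  have hqZ : q ∈ Zᶜ := hU ▸ Or.inr hq
  obtain ⟨w⟩ := (hG.2 Z hZ).preconnected ⟨p, hpZ⟩ ⟨q, hqZ⟩
  obtain ⟨d, -, hd, hd'⟩ := w.exists_boundary_dart {x | x.1 ∈ P} hp
    (fun h => hPQ.notMem_of_mem_left h hq)
  have hsnd : d.snd.1 ∈ P ∪ Q := hU ▸ d.snd.2
  exact ⟨_, hd, _, hsnd.resolve_left hd', d.adj⟩

lemma sepEdges_comm (G : SimpleGraph V) (A B : Set V) : sepEdges G A B = sepEdges G B A := by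
  have key : ∀ C D : Set V, sepEdges G C D ⊆ sepEdges G D C := by
    rintro C D e ⟨he, a, b, rfl, ha, hb⟩
    exact ⟨he, b, a, Sym2.eq_swap, hb, ha⟩
  exact (key A B).antisymm (key B A)

lemma mem_sepEdges_of_adj {G : SimpleGraph V} {A B : Set V} {a b : V} (h : G.Adj a b)
    (ha : a ∈ A \ B) (hb : b ∈ B \ A) : s(a, b) ∈ sepEdges G A B :=
  ⟨h, a, b, rfl, ha, hb⟩

lemma IsVertexSep.symm {G : SimpleGraph V} {A B : Set V} {k : ℕ} (h : IsVertexSep G A B k) :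
    IsVertexSep G B A k := by
  obtain ⟨⟨hU, hA, hB⟩, hE, hO⟩ := h
  refine ⟨⟨union_comm A B ▸ hU, hB, hA⟩, sepEdges_comm G A B ▸ hE, ?_⟩
  rwa [sepOrder, inter_comm, sepEdges_comm]

lemma IsVertexSep.encard_inter {G : SimpleGraph V} {A B : Set V} {k : ℕ}
    (h : IsVertexSep G A B k) : (A ∩ B).encard = k := by
  simpa [sepOrder, h.2.1] using h.2.2

lemma IsVertexSep.not_adj {G : SimpleGraph V} {A B : Set V} {k : ℕ}
    (h : IsVertexSep G A B k) {a b : V} (ha : a ∈ A \ B) (hb : b ∈ B \ A) : ¬ G.Adj a b :=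
  fun hab => (h.2.1 ▸ mem_sepEdges_of_adj hab ha hb : s(a, b) ∈ (∅ : Set (Sym2 V)))

/-- In a `k`-connected graph every vertex of a `k`-separator has a neighbour on each side. -/
lemma IsVertexSep.exists_adj {G : SimpleGraph V} {A B : Set V} {k : ℕ} (hG : KConnected G k)
    (h : IsVertexSep G A B k) {v : V} (hv : v ∈ A ∩ B) : ∃ a ∈ A \ B, G.Adj v a := by
  have hcard := h.encard_inter
  have hfin : (A ∩ B).Finite := finite_of_encard_eq_coe hcard
  have hZ : ((A ∩ B) \ {v}).encard < k :=
    hcard ▸ (hfin.subset sdiff_subset).encard_lt_encard (sdiff_singleton_ssubset.2 hv)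
  obtain ⟨p, hp, q, hq, hpq⟩ := hG.exists_adj_of_compl_eq_union hZ h.1.2.1
    (Q := insert v (B \ A)) (insert_nonempty _ _)
    (by rw [Set.disjoint_left]; grind)
    (by ext x; have := eq_univ_iff_forall.1 h.1.1 x; grind)
  rcases hq with rfl | hq
  · exact ⟨p, hp, hpq.symm⟩
  · exact absurd hpq (h.not_adj hp hq)

/-- In a `k`-connected graph, two vertices of a `k`-separator cannot have the same vertex as their
only neighbour on a side with at least two vertices. -/
lemma IsVertexSep.eq_of_forall_adj_eq {G : SimpleGraph V} {A B : Set V} {k : ℕ}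
    (hG : KConnected G k) (h : IsVertexSep G A B k) (hA : (A \ B).Nontrivial) {x y a : V}
    (hx : x ∈ A ∩ B) (hy : y ∈ A ∩ B) (hxa : ∀ c ∈ A \ B, G.Adj x c → c = a)
    (hya : ∀ c ∈ A \ B, G.Adj y c → c = a) : x = y := by
  by_contra hxy
  have hcard := h.encard_inter
  have hfin : (A ∩ B).Finite := finite_of_encard_eq_coe hcard
  have hZ : (insert a ((A ∩ B) \ {x, y})).encard < k := by
    have h2 : ((A ∩ B) \ {x, y}).encard + 2 = k := by
      rw [← encard_pair hxy, ← hcard]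
      exact encard_sdiff_add_encard_of_subset (by grind)
    have hfin' : ((A ∩ B) \ {x, y}).encard ≠ ⊤ := (hfin.subset sdiff_subset).encard_lt_top.ne
    refine (encard_insert_le _ _).trans_lt ?_
    rw [← h2]
    exact (ENat.add_lt_add_iff_left hfin').2 (by norm_num)
  by_cases ha : a ∈ A \ B
  · obtain ⟨c, hc, hca⟩ := hA.exists_ne a
    obtain ⟨p, hp, q, hq, hpq⟩ := hG.exists_adj_of_compl_eq_union hZ
      (P := (A \ B) \ {a}) ⟨c, hc, hca⟩ (Q := (B \ A) ∪ {x, y}) ⟨x, by simp⟩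
      (by rw [Set.disjoint_left]; grind)
      (by ext z; have := eq_univ_iff_forall.1 h.1.1 z; grind)
    rcases hq with hq | rfl | rfl
    · exact h.not_adj hp.1 hq hpq
    · exact hp.2 (hxa p hp.1 hpq.symm)
    · exact hp.2 (hya p hp.1 hpq.symm)
  · obtain ⟨c, hc, hxc⟩ := h.exists_adj hG hx
    exact ha (hxa c hc hxc ▸ hc)

/-- Assigning to each vertex of `T` an edge to a vertex outside `T` is injective. -/
lemma injOn_sym2_mk {T : Set V} {f : V → V} (hf : ∀ v ∈ T, f v ∉ T) :
    InjOn (fun v => s(v, f v)) T := by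
  intro v hv w hw hvw
  rcases Sym2.eq_iff.1 hvw with h | h
  · exact h.1
  · exact absurd (h.1 ▸ hv) (hf w hw)

/-- A `4`-separation of a `4`-connected graph with at least two vertices on both sides gives rise
to a tetra-separation: move each vertex of the separator with a unique neighbour on one side
to the other side. -/
lemma IsVertexSep.exists_isTetraSep {G : SimpleGraph V} (hG : KConnected G 4) {A B : Set V}
    (h : IsVertexSep G A B 4) (hA : (A \ B).Nontrivial) (hB : (B \ A).Nontrivial) :
    ∃ C D : Set V, IsTetraSep G C D := by
  have hU : ∀ x, x ∈ A ∨ x ∈ B := eq_univ_iff_forall.1 h.1.1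
  have hnbA : ∀ v ∈ A ∩ B, ∃ a ∈ A \ B, G.Adj v a := fun v hv => h.exists_adj hG hv
  have hnbB : ∀ v ∈ A ∩ B, ∃ b ∈ B \ A, G.Adj v b :=
    fun v hv => h.symm.exists_adj hG (inter_comm A B ▸ hv)
  set X : Set V := {v | v ∈ A ∩ B ∧ (G.neighborSet v ∩ (A \ B)).encard ≤ 1}
  set Y : Set V := {v | v ∈ (A ∩ B) \ X ∧ (G.neighborSet v ∩ (B \ A ∪ X)).encard ≤ 1}
  have hXu : ∀ v ∈ X, ∀ c ∈ A \ B, G.Adj v c → ∀ d ∈ A \ B, G.Adj v d → c = d :=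
    fun v hv c hc hvc d hd hvd => encard_le_one_iff.1 hv.2 c d ⟨hvc, hc⟩ ⟨hvd, hd⟩
  have hYu : ∀ v ∈ Y, ∀ c ∈ B \ A ∪ X, G.Adj v c → ∀ d ∈ B \ A ∪ X, G.Adj v d → c = d :=
    fun v hv c hc hvc d hd hvd => encard_le_one_iff.1 hv.2 c d ⟨hvc, hc⟩ ⟨hvd, hd⟩
  have hXS : X ⊆ A ∩ B := fun v hv => hv.1
  have hYS : Y ⊆ A ∩ B := fun v hv => hv.1.1
  have hXY : ∀ v ∈ Y, v ∉ X := fun v hv => hv.1.2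
  have hf : ∀ v ∈ X ∪ Y, ∃ w, G.Adj v w ∧ (v ∈ X → w ∈ A \ B) ∧ (v ∈ Y → w ∈ B \ A) := by
    rintro v (hv | hv)
    · obtain ⟨a, ha, hva⟩ := hnbA v (hXS hv)
      exact ⟨a, hva, fun _ => ha, fun hv' => absurd hv (hXY v hv')⟩
    · obtain ⟨b, hb, hvb⟩ := hnbB v (hYS hv)
      exact ⟨b, hvb, fun hv' => absurd hv' (hXY v hv), fun _ => hb⟩
  have : Nonempty V := hA.nonempty.to_type
  choose! f hfadj hfX hfY using hf
  have hCD : (A \ X) \ (B \ Y) = A \ B ∪ Y := by ext; grind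
  have hDC : (B \ Y) \ (A \ X) = B \ A ∪ X := by ext; grind
  have hS : (A \ X) ∩ (B \ Y) = (A ∩ B) \ (X ∪ Y) := by ext; grind
  have hE : sepEdges G (A \ X) (B \ Y) = (fun v => s(v, f v)) '' (X ∪ Y) := by
    apply Subset.antisymm
    · rintro e ⟨he, a, b, rfl, ha, hb⟩
      rw [hCD] at ha
      rw [hDC] at hb
      have hab : G.Adj a b := he
      rcases ha with ha | ha
      · rcases hb with hb | hb
        · exact absurd hab (h.not_adj ha hb)
        · refine ⟨b, Or.inl hb, ?_⟩
          rw [hXu b hb a ha hab.symm (f b) (hfX b (Or.inl hb) hb) (hfadj b (Or.inl hb))]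
          exact Sym2.eq_swap
      · refine ⟨a, Or.inr ha, ?_⟩
        rw [hYu a ha b hb hab (f a) (Or.inl (hfY a (Or.inr ha) ha)) (hfadj a (Or.inr ha))]
    · rintro _ ⟨v, hv, rfl⟩
      have hadj := hfadj v hv
      have hv₁ := hfX v hv
      have hv₂ := hfY v hv
      rcases hv with hv | hv
      · rw [sepEdges_comm]
        exact mem_sepEdges_of_adj hadj (hDC ▸ Or.inr hv) (hCD ▸ Or.inl (hv₁ hv))
      · exact mem_sepEdges_of_adj hadj (hCD ▸ Or.inr hv) (hDC ▸ Or.inl (hv₂ hv))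
  have hfS : ∀ v ∈ X ∪ Y, f v ∉ A ∩ B := by
    rintro v (hv | hv) hvS
    · exact (hfX v (Or.inl hv) hv).2 hvS.2
    · exact (hfY v (Or.inr hv) hv).2 hvS.1
  have hXYS : X ∪ Y ⊆ A ∩ B := union_subset hXS hYS
  have hfinj : ∀ v ∈ X ∪ Y, ∀ w ∈ X ∪ Y, f v = f w → v = w := by
    intro v hv w hw hvw
    have hvf := hfadj v hv
    have hwf := hfadj w hw
    have hv₁ := hfX v hv
    have hv₂ := hfY v hv
    have hw₁ := hfX w hw
    have hw₂ := hfY w hw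
    rcases hv with hv | hv <;> rcases hw with hw | hw
    · exact h.eq_of_forall_adj_eq hG hA (a := f v) (hXS hv) (hXS hw)
        (fun c hc hvc => hXu v hv c hc hvc _ (hv₁ hv) hvf)
        (fun c hc hwc => hvw ▸ hXu w hw c hc hwc _ (hw₁ hw) hwf)
    · exact absurd (hv₁ hv).1 (hvw ▸ (hw₂ hw).2)
    · exact absurd (hw₁ hw).1 (hvw ▸ (hv₂ hv).2)
    · exact h.symm.eq_of_forall_adj_eq hG hB (a := f v) (hYS hv).symm (hYS hw).symm
        (fun c hc hvc => hYu v hv c (Or.inl hc) hvc _ (Or.inl (hv₂ hv)) hvf)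
        (fun c hc hwc => hvw ▸ hYu w hw c (Or.inl hc) hwc _ (Or.inl (hw₂ hw)) hwf)
  refine ⟨A \ X, B \ Y, ⟨?_, ?_, ?_⟩, ?_, ?_, ?_⟩
  · ext x
    have := hU x
    grind
  · exact hCD ▸ hA.nonempty.inl
  · exact hDC ▸ hB.nonempty.inl
  · rw [sepOrder, hS, hE, (injOn_sym2_mk fun v hv hv' => hfS v hv (hXYS hv')).encard_image,
      encard_sdiff_add_encard_of_subset hXYS]
    exact h.encard_inter
  · intro v hv
    rw [hS] at hv
    rw [hCD, hDC]
    have hvX : v ∉ X := fun hv' => hv.2 (Or.inl hv')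
    have hvY : v ∉ Y := fun hv' => hv.2 (Or.inr hv')
    constructor
    · have h1 : 1 < (G.neighborSet v ∩ (A \ B)).encard := not_le.1 fun hle => hvX ⟨hv.1, hle⟩
      exact (Order.add_one_le_of_lt h1).trans
        (encard_le_encard (inter_subset_inter_right _ subset_union_left))
    · exact Order.add_one_le_of_lt (not_le.1 fun hle => hvY ⟨⟨hv.1, hvX⟩, hle⟩)
  · intro e he e' he' hne u hu hu'
    rw [hE] at he he'
    obtain ⟨v, hv, rfl⟩ := he
    obtain ⟨w, hw, rfl⟩ := he'
    have hvw : v ≠ w := fun hvw => hne (by rw [hvw])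
    have hv' := hfS v hv
    have hw' := hfS w hw
    have hvS := hXYS hv
    have hwS := hXYS hw
    rcases Sym2.mem_iff.1 hu with rfl | rfl <;> rcases Sym2.mem_iff.1 hu' with h' | h'
    · exact hvw h'
    · exact hw' (h' ▸ hvS)
    · exact hv' (h' ▸ hwS)
    · exact hvw (hfinj v hv w hw h')

/-- Both sides of a tetra-separation have at least two vertices. -/
lemma IsTetraSep.nontrivial {G : SimpleGraph V} {A B : Set V} (h : IsTetraSep G A B) :
    (A \ B).Nontrivial ∧ (B \ A).Nontrivial := by
  obtain ⟨-, hO, hdeg, hM⟩ := h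
  rcases (A ∩ B).eq_empty_or_nonempty with hS | ⟨v, hv⟩
  · rw [sepOrder, hS, encard_empty, zero_add] at hO
    obtain ⟨e, he, e', he', hne⟩ :=
      one_lt_encard_iff_nontrivial.1 (hO ▸ by norm_num : 1 < (sepEdges G A B).encard)
    have hdisj := hM e he e' he' hne
    obtain ⟨-, a, b, rfl, ha, hb⟩ := he
    obtain ⟨-, a', b', rfl, ha', hb'⟩ := he'
    refine ⟨⟨a, ha, a', ha', ?_⟩, ⟨b, hb, b', hb', ?_⟩⟩
    · rintro rfl
      exact hdisj a (by simp) (by simp)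
    · rintro rfl
      exact hdisj b (by simp) (by simp)
  · have hnt : ∀ T : Set V, 2 ≤ (G.neighborSet v ∩ T).encard → T.Nontrivial := fun T hT =>
      (one_lt_encard_iff_nontrivial.1
        (lt_of_lt_of_le (by norm_num) hT)).mono inter_subset_right
    exact ⟨hnt _ (hdeg v hv).1, hnt _ (hdeg v hv).2⟩

lemma exists_nat_split {p q : ℕ∞} {k : ℕ} (hp : 2 ≤ p) (hq : 2 ≤ q) (h : 4 + k ≤ p + q) :
    ∃ j l : ℕ, j + l = k ∧ (2 + j : ℕ∞) ≤ p ∧ (2 + l : ℕ∞) ≤ q := by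
  by_cases hk : (2 + k : ℕ∞) ≤ p
  · exact ⟨k, 0, rfl, hk, by simpa using hq⟩
  · have hlt := not_le.1 hk
    lift p to ℕ using hlt.ne_top
    norm_cast at hp hlt
    refine ⟨p - 2, k + 2 - p, by omega, by norm_cast; omega, ?_⟩
    induction q with
    | top => exact le_top
    | coe q =>
      norm_cast at h ⊢
      omega

/-- A tetra-separation of a graph with at least eight vertices gives rise to a `4`-separation
with at least two vertices on both sides: replace each edge of the separator by a suitable
endvertex. -/
lemma IsTetraSep.exists_isVertexSep {G : SimpleGraph V} {A B : Set V} (h : IsTetraSep G A B)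
    (hV : (8 : ℕ∞) ≤ (univ : Set V).encard) :
    ∃ C D : Set V, IsVertexSep G C D 4 ∧ (C \ D).Nontrivial ∧ (D \ C).Nontrivial := by
  obtain ⟨hA, hB⟩ := h.nontrivial
  obtain ⟨⟨hU, -, -⟩, hO, -, hM⟩ := h
  have hU' : ∀ x, x ∈ A ∨ x ∈ B := eq_univ_iff_forall.1 hU
  have : Nonempty V := hA.nonempty.to_type
  set P : Set V := {a | a ∈ A \ B ∧ ∃ b ∈ B \ A, G.Adj a b}
  have hg : ∀ a ∈ P, ∃ b, b ∈ B \ A ∧ G.Adj a b := fun a ha => ha.2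
  choose! g hgB hgadj using hg
  have hPA : P ⊆ A \ B := fun a ha => ha.1
  have hgE : ∀ a ∈ P, s(a, g a) ∈ sepEdges G A B := fun a ha =>
    mem_sepEdges_of_adj (hgadj a ha) ha.1 (hgB a ha)
  have hguniq : ∀ a ∈ A \ B, ∀ b ∈ B \ A, G.Adj a b → a ∈ P ∧ b = g a := by
    intro a ha b hb hab
    have haP : a ∈ P := ⟨ha, b, hb, hab⟩
    refine ⟨haP, ?_⟩
    by_contra hne
    exact hM _ (mem_sepEdges_of_adj hab ha hb) _ (hgE a haP)
      (fun he => hne (Sym2.congr_right.1 he)) a (by simp) (by simp)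
  have hginj : InjOn g P := by
    intro a ha a' ha' haa
    by_contra hne
    exact hM _ (hgE a ha) _ (hgE a' ha')
      (fun he => hne (Sym2.congr_left.1 (haa ▸ he))) (g a) (by simp) (by simp [haa])
  have hE : sepEdges G A B = (fun a => s(a, g a)) '' P := by
    apply Subset.antisymm
    · rintro e ⟨he, a, b, rfl, ha, hb⟩
      obtain ⟨haP, rfl⟩ := hguniq a ha b hb he
      exact ⟨a, haP, rfl⟩
    · rintro _ ⟨a, ha, rfl⟩
      exact hgE a ha
  have hO' : (A ∩ B).encard + P.encard = 4 := by
    rw [← hO, sepOrder, hE,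
      (injOn_sym2_mk fun a ha ha' => (hgB a ha).2 (hPA ha').1).encard_image]
  have hPfin : P.encard ≠ ⊤ := by
    intro ht
    rw [ht, add_top] at hO'
    exact ENat.top_ne_ofNat 4 hO'
  have hSfin : (A ∩ B).encard ≠ ⊤ := by
    intro ht
    rw [ht, top_add] at hO'
    exact ENat.top_ne_ofNat 4 hO'
  obtain ⟨k, hk⟩ := ENat.ne_top_iff_exists.1 hPfin
  have hsum : (4 + k : ℕ∞) ≤ (A \ B).encard + (B \ A).encard := by
    have hunion : (univ : Set V).encard ≤ (A ∩ B).encard + ((A \ B).encard + (B \ A).encard) := by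
      have huniv : (univ : Set V) = (A ∩ B) ∪ ((A \ B) ∪ (B \ A)) := by
        ext x
        have := hU' x
        grind
      rw [huniv]
      exact (encard_union_le _ _).trans (add_le_add_right (encard_union_le _ _) _)
    have h8 := hV.trans hunion
    refine (ENat.add_le_add_iff_left hSfin).1 (le_trans (le_of_eq ?_) h8)
    rw [hk, add_left_comm, hO']
    norm_num
  have two_le : ∀ {T : Set V}, T.Nontrivial → 2 ≤ T.encard := fun hT =>
    Order.add_one_le_of_lt (one_lt_encard_iff_nontrivial.2 hT)
  obtain ⟨j, l, hjl, hj, hl⟩ := exists_nat_split (two_le hA) (two_le hB) hsum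
  obtain ⟨J, hJP, hJ⟩ := exists_subset_encard_eq (s := P) (k := j)
    (by rw [← hk]; exact_mod_cast (by omega : j ≤ k))
  have hPJ : (P \ J).encard = l := by
    have hadd := encard_sdiff_add_encard_of_subset hJP
    rw [hJ, ← hk, ← hjl, Nat.cast_add, add_comm] at hadd
    exact WithTop.add_left_cancel (ENat.natCast_ne_top j) hadd
  set L : Set V := g '' (P \ J) with hL
  have hLcard : L.encard = l := by rw [hL, (hginj.mono sdiff_subset).encard_image, hPJ]
  have hJA : J ⊆ A \ B := hJP.trans hPA
  have hLB : L ⊆ B \ A := by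
    rintro _ ⟨a, ha, rfl⟩
    exact hgB a ha.1
  have hCD : (A ∪ L) \ (B ∪ J) = (A \ B) \ J := by ext; grind
  have hDC : (B ∪ J) \ (A ∪ L) = (B \ A) \ L := by ext; grind
  have hS : (A ∪ L) ∩ (B ∪ J) = (A ∩ B) ∪ (J ∪ L) := by ext; grind
  have diff_nontrivial : ∀ {T R : Set V} {n : ℕ}, R ⊆ T → R.encard = n →
      (2 + n : ℕ∞) ≤ T.encard → (T \ R).Nontrivial := by
    intro T R n hRT hR hT
    rw [← encard_sdiff_add_encard_of_subset hRT, hR] at hT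
    exact one_lt_encard_iff_nontrivial.1 (lt_of_lt_of_le (by norm_num)
      ((ENat.add_le_add_iff_right (ENat.natCast_ne_top n)).1 hT))
  have hAJ := diff_nontrivial hJA hJ hj
  have hBL := diff_nontrivial hLB hLcard hl
  have hE' : sepEdges G (A ∪ L) (B ∪ J) = ∅ := by
    rw [eq_empty_iff_forall_notMem]
    rintro e ⟨he, a, b, rfl, ha, hb⟩
    rw [hCD] at ha
    rw [hDC] at hb
    obtain ⟨haP, rfl⟩ := hguniq a ha.1 b hb.1 he
    exact hb.2 ⟨a, ⟨haP, ha.2⟩, rfl⟩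
  refine ⟨A ∪ L, B ∪ J, ⟨⟨?_, hCD ▸ hAJ.nonempty, hDC ▸ hBL.nonempty⟩, hE', ?_⟩,
    hCD ▸ hAJ, hDC ▸ hBL⟩
  · ext x
    have := hU' x
    grind
  · have hd₁ : Disjoint J L := by rw [Set.disjoint_left]; grind
    have hd₂ : Disjoint (A ∩ B) (J ∪ L) := by rw [Set.disjoint_left]; grind
    rw [sepOrder, hE', encard_empty, add_zero, hS, encard_union_eq hd₂, encard_union_eq hd₁, hJ,
      hLcard, ← Nat.cast_add, hjl, hk, hO']
    rfl

/-- quasi-5-connectivity versus tetra-separations. -/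
theorem quasi_five_connected_vs_tetra (G : SimpleGraph V) (hG : KConnected G 4) :
    ((∀ A B : Set V, ¬ IsTetraSep G A B) → QuasiConnected G 5) ∧
      (QuasiConnected G 5 → (8 : ℕ∞) ≤ (Set.univ : Set V).encard →
        ∀ A B : Set V, ¬ IsTetraSep G A B) := by
  have nontrivial_iff : ∀ T : Set V, T.Nonempty → (T.Nontrivial ↔ T.encard ≠ 1) := fun T hT => by
    rw [← one_lt_encard_iff_nontrivial, lt_iff_le_and_ne, ne_comm]
    exact and_iff_right (one_le_encard_iff_nonempty.2 hT)
  refine ⟨fun h => ⟨hG, fun A B hAB => ?_⟩, fun hQ hV A B hAB => ?_⟩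
  · by_contra! hne
    obtain ⟨C, D, hCD⟩ := hAB.exists_isTetraSep hG
      ((nontrivial_iff _ hAB.1.2.1).2 hne.1) ((nontrivial_iff _ hAB.1.2.2).2 hne.2)
    exact h C D hCD
  · obtain ⟨C, D, hCD, hC, hD⟩ := hAB.exists_isVertexSep hV
    exact (hQ.2 C D hCD).elim ((nontrivial_iff _ hC.nonempty).1 hC)
      ((nontrivial_iff _ hD.nonempty).1 hD)
end Paper
end

section
/- Let (A,B) and (C,D) be crossing tetra-separations in a 4-connected graph G. Then exactly one of the following assertions holds: (1) all four links are empty and the centre has size four; (2) all four links have size one and the centre has size two; (3) all four links have size two and the centre is empty. Moreover, there are no diagonal edges and no jumping edges, and if some edge dangles from one link through another, then case (3) holds and the corner in between the two links is potter. -/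
open Set

namespace Paper

variable {V : Type*}

variable {G : SimpleGraph V} {A B C D : Set V}

lemma sepEdges_swap (G : SimpleGraph V) (A B : Set V) : sepEdges G B A = sepEdges G A B := by
  ext e
  constructor <;> rintro ⟨he, a, b, rfl, ha, hb⟩ <;> exact ⟨he, b, a, Sym2.eq_swap, hb, ha⟩

lemma mk_mem_sepEdges {x y : V} (h : G.Adj x y) (hx : x ∈ A \ B) (hy : y ∈ B \ A) :
    s(x, y) ∈ sepEdges G A B :=
  ⟨h, x, y, rfl, hx, hy⟩

lemma IsTetraSep.swap (h : IsTetraSep G A B) : IsTetraSep G B A := by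
  obtain ⟨⟨h1, h2, h3⟩, h4, h5, h6⟩ := h
  refine ⟨⟨by rw [union_comm, h1], h3, h2⟩, ?_, ?_, ?_⟩
  · rw [sepOrder, inter_comm, sepEdges_swap]; exact h4
  · intro v hv
    exact (h5 v hv.symm).symm
  · rw [MatchingCondition, sepEdges_swap]; exact h6

lemma Crosses.swap_left (h : Crosses A B C D) : Crosses B A C D := by
  unfold Crosses Nested at *; tauto

lemma Crosses.swap_right (h : Crosses A B C D) : Crosses A B D C := by
  unfold Crosses Nested at *; tauto

lemma isDiagonal_swap_left {e : Sym2 V} : IsDiagonal G B A C D e ↔ IsDiagonal G A B C D e := by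
  constructor <;> rintro ⟨he, a, b, rfl, h⟩ <;>
    exact ⟨he, b, a, Sym2.eq_swap, by tauto⟩

lemma isDiagonal_swap_right {e : Sym2 V} : IsDiagonal G A B D C e ↔ IsDiagonal G A B C D e := by
  constructor <;> rintro ⟨he, a, b, rfl, h⟩ <;>
    exact ⟨he, a, b, rfl, by tauto⟩

lemma corner_comm (A B C D : Set V) : corner C D A B = corner A B C D :=
  inter_comm _ _

lemma isDiagonal_comm {e : Sym2 V} : IsDiagonal G C D A B e ↔ IsDiagonal G A B C D e := by
  unfold IsDiagonal
  simp only [corner_comm A B C D, corner_comm B A D C, corner_comm B A C D, corner_comm A B D C]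
  constructor <;> rintro ⟨he, a, b, rfl, h | h⟩
  · exact ⟨he, a, b, rfl, Or.inl h⟩
  · exact ⟨he, b, a, Sym2.eq_swap, Or.inr h.symm⟩
  · exact ⟨he, a, b, rfl, Or.inl h⟩
  · exact ⟨he, b, a, Sym2.eq_swap, Or.inr h.symm⟩

lemma link_swap (G : SimpleGraph V) (A B C D : Set V) : link G B A C D = link G A B C D := by
  unfold link
  simp only [isDiagonal_swap_left, sepEdges_swap G A B, inter_comm B A, or_comm]

@[simp] lemma inl_mem_link {v : V} :
    Sum.inl v ∈ link G A B C D ↔ (v ∈ C ∧ v ∉ D) ∧ v ∈ A ∧ v ∈ B := by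
  simp [link]

@[simp] lemma inr_mem_link {e : Sym2 V} :
    Sum.inr e ∈ link G A B C D ↔ e ∈ sepEdges G A B ∧ ¬ IsDiagonal G A B C D e ∧
      ∃ v : V, v ∈ e ∧ (v ∈ corner A B C D ∨ v ∈ corner B A C D) := by
  simp only [link, mem_union, mem_image, reduceCtorEq, and_false, exists_false, false_or,
    Sum.inr.injEq, exists_eq_right, mem_ofPred_eq]

/-- An edge from `A \ B` to `B \ A` both of whose ends lie in `C`, one of them properly,
belongs to the `C`-link. -/
lemma inr_mem_link_of_adj {x y : V} (h : G.Adj x y) (hx : x ∈ A \ B) (hy : y ∈ B \ A)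
    (hxC : x ∈ C) (hyC : y ∈ C) (hD : x ∉ D ∨ y ∉ D) : Sum.inr s(x, y) ∈ link G A B C D := by
  refine inr_mem_link.2 ⟨mk_mem_sepEdges h hx hy, ?_, ?_⟩
  · rintro ⟨-, a, b, hab, h⟩
    simp only [corner, mem_inter_iff, mem_sdiff] at h
    rcases Sym2.eq_iff.1 hab with ⟨rfl, rfl⟩ | ⟨rfl, rfl⟩ <;> tauto
  · rcases hD with hD | hD
    · exact ⟨x, Sym2.mem_mk_left _ _, Or.inl ⟨hx, hxC, hD⟩⟩
    · exact ⟨y, Sym2.mem_mk_right _ _, Or.inr ⟨hy, hyC, hD⟩⟩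

lemma exists_of_inr_mem_link (hCD : C ∪ D = univ) {e : Sym2 V}
    (he : Sum.inr e ∈ link G A B C D) :
    ∃ x y, e = s(x, y) ∧ G.Adj x y ∧ x ∈ A \ B ∧ y ∈ B \ A ∧ x ∈ C ∧ y ∈ C ∧
      (x ∉ D ∨ y ∉ D) := by
  obtain ⟨⟨hadj, x, y, rfl, hx, hy⟩, hnd, v, hv, hvc⟩ := inr_mem_link.1 he
  have key : ∀ z, z ∈ C ∨ z ∈ D := fun z => by
    have : z ∈ C ∪ D := hCD ▸ mem_univ z
    exact this
  have h1 : ¬ (x ∈ corner A B C D ∧ y ∈ corner B A D C) := fun h =>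
    hnd ⟨hadj, x, y, rfl, Or.inl h⟩
  have h2 : ¬ (x ∈ corner A B D C ∧ y ∈ corner B A C D) := fun h =>
    hnd ⟨hadj, x, y, rfl, Or.inr h⟩
  have kx := key x
  have ky := key y
  simp only [corner, mem_inter_iff, mem_sdiff] at h1 h2 hvc hx hy
  refine ⟨x, y, rfl, hadj, hx, hy, ?_⟩
  rcases Sym2.mem_iff.1 hv with rfl | rfl <;> tauto

/-- A `k`-connected graph has no mixed-separation of order less than `k`. -/
lemma KConnected.le_sepOrder {k : ℕ} (hG : KConnected G k) (h : IsMixedSep A B) :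
    (k : ℕ∞) ≤ sepOrder G A B := by
  obtain ⟨hcov, hA, hB⟩ := h
  by_contra! hlt
  have hcov' : ∀ z, z ∈ A ∨ z ∈ B := fun z => by
    have : z ∈ A ∪ B := hcov ▸ mem_univ z
    exact this
  by_cases hcomp : ∃ u ∈ A \ B, ∃ v ∈ B \ A, ¬ G.Adj u v
  · obtain ⟨u, hu, v, hv, huv⟩ := hcomp
    have hne : u ≠ v := fun h => hu.2 (h ▸ hv.1)
    have hpick : ∀ e ∈ sepEdges G A B, ∃ w ∈ e, w ≠ u ∧ w ≠ v := by
      rintro _ ⟨hadj, x, y, rfl, hx, hy⟩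
      by_cases hxu : x = u
      · subst hxu
        refine ⟨y, Sym2.mem_mk_right _ _, fun h => hy.2 (h ▸ hx.1), ?_⟩
        rintro rfl
        exact huv hadj
      · exact ⟨x, Sym2.mem_mk_left _ _, hxu, fun h => hx.2 (h ▸ hv.1)⟩
    have : Nonempty V := ⟨u⟩
    choose! f hfe hfu hfv using hpick
    set X : Set V := (A ∩ B) ∪ f '' sepEdges G A B with hX
    have hXlt : X.encard < k :=
      ((encard_union_le _ _).trans (add_le_add_right (encard_image_le _ _) _)).trans_lt hlt
    have huX : u ∉ X := by
      rintro (h | ⟨e, he, rfl⟩)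
      · exact hu.2 h.2
      · exact hfu e he rfl
    have hvX : v ∉ X := by
      rintro (h | ⟨e, he, rfl⟩)
      · exact hv.2 h.1
      · exact hfv e he rfl
    obtain ⟨p⟩ := (hG.2 X hXlt).preconnected ⟨u, huX⟩ ⟨v, hvX⟩
    have hstep : ∀ (x y : (Xᶜ : Set V)), (G.induce (Xᶜ : Set V)).Walk x y →
        x.1 ∈ A \ B → y.1 ∈ A \ B := by
      intro x y p
      induction p with
      | nil => exact id
      | @cons x y z hxy _ ih =>
        intro hx
        apply ih
        have hxy' : G.Adj x.1 y.1 := hxy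
        by_contra hy
        have hyAB : y.1 ∉ A ∩ B := fun h => y.2 (Or.inl h)
        have hy' : y.1 ∈ B \ A := by
          have := hcov' y.1
          simp only [mem_sdiff, mem_inter_iff] at *
          tauto
        have he := mk_mem_sepEdges hxy' hx hy'
        rcases Sym2.mem_iff.1 (hfe _ he) with h | h
        · exact x.2 (Or.inr ⟨_, he, h⟩)
        · exact y.2 (Or.inr ⟨_, he, h⟩)
    exact hv.2 (hstep _ _ p hu).1
  · push Not at hcomp
    obtain ⟨u, hu⟩ := hA
    obtain ⟨v, hv⟩ := hB
    have hsub : (fun y => s(u, y)) '' (B \ A) ∪ (fun x => s(x, v)) '' ((A \ B) \ {u})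
        ⊆ sepEdges G A B := by
      rintro _ (⟨y, hy, rfl⟩ | ⟨x, hx, rfl⟩)
      · exact mk_mem_sepEdges (hcomp u hu y hy) hu hy
      · exact mk_mem_sepEdges (hcomp x hx.1 v hv) hx.1 hv
    have hdisj : Disjoint ((fun y => s(u, y)) '' (B \ A))
        ((fun x => s(x, v)) '' ((A \ B) \ {u})) := by
      rw [disjoint_left]
      rintro _ ⟨y, hy, rfl⟩ ⟨x, hx, hxy⟩
      rcases Sym2.eq_iff.1 hxy with ⟨h, -⟩ | ⟨h, -⟩
      · exact hx.2 h
      · exact hy.2 (h ▸ hx.1.1)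
    have hcard := encard_le_encard hsub
    rw [encard_union_eq hdisj, InjOn.encard_image, InjOn.encard_image] at hcard
    · have huniv : (univ : Set V) = (A ∩ B) ∪ ((B \ A) ∪ (((A \ B) \ {u}) ∪ {u})) := by
        ext z
        have := hcov' z
        simp only [mem_univ, mem_union, mem_inter_iff, mem_sdiff, mem_singleton_iff, true_iff]
        tauto
      have h1 : (univ : Set V).encard ≤ sepOrder G A B + 1 := by
        rw [huniv, sepOrder, add_assoc]
        refine (encard_union_le _ _).trans (add_le_add_right ?_ _)
        refine le_trans ?_ (add_le_add_left hcard 1)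
        rw [add_assoc]
        refine (encard_union_le _ _).trans (add_le_add_right ?_ _)
        refine (encard_union_le _ _).trans ?_
        rw [encard_singleton]
      exact absurd (hG.1.trans_le h1) (not_lt.2 (Order.add_one_le_of_lt hlt))
    · exact fun x _ y _ hxy => Sym2.congr_left.1 hxy
    · exact fun x _ y _ hxy => Sym2.congr_right.1 hxy

lemma encard_sepElems (G : SimpleGraph V) (A B : Set V) :
    (sepElems G A B).encard = sepOrder G A B := by
  rw [sepElems, encard_union_eq, Sum.inl_injective.encard_image, Sum.inr_injective.encard_image,
    sepOrder]
  rw [disjoint_left]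
  rintro _ ⟨x, -, rfl⟩ ⟨y, -, h⟩
  cases h

/-- The separator of the mixed-separation `(A ∩ C, B ∪ D)` is contained in the
corner-separator at `AC`. -/
lemma sepElems_subset_cornerSep (hAB : A ∪ B = univ) (hCD : C ∪ D = univ) :
    sepElems G (A ∩ C) (B ∪ D) ⊆ cornerSep G A B C D := by
  have kAB : ∀ z, z ∈ A ∨ z ∈ B := fun z => by
    have : z ∈ A ∪ B := hAB ▸ mem_univ z
    exact this
  have kCD : ∀ z, z ∈ C ∨ z ∈ D := fun z => by
    have : z ∈ C ∪ D := hCD ▸ mem_univ z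
    exact this
  rintro _ (⟨v, hv, rfl⟩ | ⟨_, ⟨hadj, x, y, rfl, hx, hy⟩, rfl⟩)
  · simp only [mem_inter_iff, mem_union] at hv
    simp only [cornerSep, mem_union, inl_mem_link, vertexCentre, mem_image, mem_inter_iff,
      Sum.inl.injEq, exists_eq_right, reduceCtorEq, and_false, exists_false, or_false]
    tauto
  · simp only [mem_sdiff, mem_inter_iff, mem_union, not_or] at hx hy
    by_cases hyA : y ∈ A
    · have hyC : y ∉ C := fun h => hy.2 ⟨hyA, h⟩
      have hyD := (kCD y).resolve_left hyC
      exact Or.inl (Or.inl (Or.inl (inr_mem_link_of_adj hadj ⟨hx.1.2, hx.2.2⟩ ⟨hyD, hyC⟩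
        hx.1.1 hyA (Or.inl hx.2.1))))
    · have hyB := (kAB y).resolve_left hyA
      by_cases hyC : y ∈ C
      · exact Or.inl (Or.inl (Or.inr (inr_mem_link_of_adj hadj ⟨hx.1.1, hx.2.1⟩ ⟨hyB, hyA⟩
          hx.1.2 hyC (Or.inl hx.2.2))))
      · have hyD := (kCD y).resolve_left hyC
        have hxc : x ∈ corner A B C D := ⟨⟨hx.1.1, hx.2.1⟩, hx.1.2, hx.2.2⟩
        exact Or.inr ⟨_, ⟨⟨hadj, x, y, rfl, Or.inl ⟨hxc, ⟨hyB, hyA⟩, hyD, hyC⟩⟩, x,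
          Sym2.mem_mk_left _ _, hxc⟩, rfl⟩

lemma isMixedSep_corner (hAB : IsMixedSep A B) (hCD : C ∪ D = univ)
    (hne : (corner A B C D).Nonempty) : IsMixedSep (A ∩ C) (B ∪ D) := by
  obtain ⟨hcov, -, b, hb⟩ := hAB
  obtain ⟨x, hx⟩ := hne
  refine ⟨?_, ⟨x, ⟨hx.1.1, hx.2.1⟩, ?_⟩, ⟨b, Or.inl hb.1, fun h => hb.2 h.1⟩⟩
  · ext z
    have h1 : z ∈ A ∪ B := hcov ▸ mem_univ z
    have h2 : z ∈ C ∪ D := hCD ▸ mem_univ z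
    simp only [mem_union, mem_inter_iff, mem_univ, iff_true] at *
    tauto
  · rintro (h | h)
    · exact hx.1.2 h
    · exact hx.2.2 h

lemma two_le_encard {α : Type*} {s : Set α} {a b : α} (ha : a ∈ s) (hb : b ∈ s) (hab : a ≠ b) :
    2 ≤ s.encard := by
  rw [← one_add_one_eq_two]
  exact Order.add_one_le_of_lt (one_lt_encard_iff.2 ⟨a, b, ha, hb, hab⟩)

lemma exists_of_two_le_encard {α : Type*} {s : Set α} (h : 2 ≤ s.encard) :
    ∃ a b, a ∈ s ∧ b ∈ s ∧ a ≠ b :=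
  one_lt_encard_iff.1 (lt_of_lt_of_le (by norm_num) h)

/-- Two edges of the separator at a common vertex of `A \ B` coincide. -/
lemma MatchingCondition.eq_of_adj (h : MatchingCondition G A B) {v x y : V} (hv : v ∈ A \ B)
    (hx : x ∈ B \ A) (hy : y ∈ B \ A) (hvx : G.Adj v x) (hvy : G.Adj v y) : x = y := by
  by_contra hne
  exact h _ (mk_mem_sepEdges hvx hv hx) _ (mk_mem_sepEdges hvy hv hy)
    (fun h => hne (Sym2.congr_right.1 h)) v (Sym2.mem_mk_left _ _) (Sym2.mem_mk_left _ _)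

/-- If the corner for `AC` is empty, then every vertex in the `A`-link has a neighbour in the
`C`-link, and another one that is either in the `C`-link or reached through an edge of it. -/
lemma exists_adj_of_corner_eq_empty (hAB : IsTetraSep G A B) (hCD : IsTetraSep G C D)
    (hemp : corner A B C D = ∅) {v : V} (hv : Sum.inl v ∈ link G C D A B) :
    ∃ u w, u ≠ w ∧ G.Adj v u ∧ G.Adj v w ∧ Sum.inl u ∈ link G A B C D ∧
      (Sum.inl w ∈ link G A B C D ∨ Sum.inr s(v, w) ∈ link G A B C D) := by
  obtain ⟨hvA, hvC⟩ := inl_mem_link.1 hv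
  obtain ⟨x, y, ⟨hvx, hx⟩, ⟨hvy, hy⟩, hxy⟩ := exists_of_two_le_encard (hCD.2.2.1 v hvC).1
  have hB : ∀ z ∈ C \ D, z ∈ B := by
    intro z hz
    have h1 : z ∈ A ∪ B := hAB.1.1 ▸ mem_univ z
    by_contra h
    exact (hemp ▸ (⟨⟨h1.resolve_right h, h⟩, hz⟩ : z ∈ corner A B C D) : z ∈ (∅ : Set V))
  have hdich : ∀ z ∈ C \ D, G.Adj v z →
      Sum.inl z ∈ link G A B C D ∨ (z ∈ B \ A ∧ Sum.inr s(v, z) ∈ link G A B C D) := by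
    intro z hz hvz
    by_cases hzA : z ∈ A
    · exact Or.inl (inl_mem_link.2 ⟨hz, hzA, hB z hz⟩)
    · exact Or.inr ⟨⟨hB z hz, hzA⟩,
        inr_mem_link_of_adj hvz hvA ⟨hB z hz, hzA⟩ hvC.1 hz.1 (Or.inr hz.2)⟩
  rcases hdich x hx hvx with h1 | ⟨h1, h1'⟩
  · exact ⟨x, y, hxy, hvx, hvy, h1, (hdich y hy hvy).imp_right And.right⟩
  · rcases hdich y hy hvy with h2 | ⟨h2, -⟩
    · exact ⟨y, x, hxy.symm, hvy, hvx, h2, Or.inr h1'⟩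
    · exact absurd (hAB.2.2.2.eq_of_adj hvA h1 h2 hvx hvy) hxy

lemma two_le_encard_link (hAB : IsTetraSep G A B) (hCD : IsTetraSep G C D)
    (hemp : corner A B C D = ∅) {v : V} (hv : Sum.inl v ∈ link G C D A B) :
    2 ≤ (link G C D A B).encard ∧ 2 ≤ (link G A B C D).encard := by
  have aux : ∀ {A B C D : Set V}, IsTetraSep G A B → IsTetraSep G C D → corner A B C D = ∅ →
      ∀ {v : V}, Sum.inl v ∈ link G C D A B → 2 ≤ (link G A B C D).encard := by
    intro A B C D hAB hCD hemp v hv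
    obtain ⟨u, w, huw, -, -, hu, hw | hw⟩ := exists_adj_of_corner_eq_empty hAB hCD hemp hv
    · exact two_le_encard hu hw (fun h => huw (Sum.inl_injective h))
    · exact two_le_encard hu hw Sum.inl_ne_inr
  obtain ⟨u, -, -, -, -, hu, -⟩ := exists_adj_of_corner_eq_empty hAB hCD hemp hv
  exact ⟨aux hCD hAB ((corner_comm A B C D).trans hemp) hu, aux hAB hCD hemp hv⟩

lemma disjoint_link_link (G : SimpleGraph V) (A B C D : Set V) :
    Disjoint (link G C D A B) (link G A B C D) := by
  rw [disjoint_left]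
  rintro (v | e) h1 h2
  · exact (inl_mem_link.1 h1).1.2 (inl_mem_link.1 h2).2.2
  · obtain ⟨⟨he, x, y, rfl, hx, hy⟩, hnd, -⟩ := inr_mem_link.1 h1
    obtain ⟨⟨-, x', y', h, hx', hy'⟩, -⟩ := inr_mem_link.1 h2
    apply hnd
    rcases Sym2.eq_iff.1 h with ⟨rfl, rfl⟩ | ⟨rfl, rfl⟩
    · exact ⟨he, _, _, rfl, Or.inl ⟨⟨hx, hx'⟩, hy, hy'⟩⟩
    · exact ⟨he, _, _, rfl, Or.inr ⟨⟨hx, hy'⟩, hy, hx'⟩⟩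

/-- All corner-separators of crossing tetra-separations have size at least four. -/
lemma four_le_encard_cornerSep (hG : KConnected G 4) (hAB : IsTetraSep G A B)
    (hCD : IsTetraSep G C D) (hcross : Crosses A B C D) :
    4 ≤ (cornerSep G A B C D).encard := by
  rcases (corner A B C D).eq_empty_or_nonempty with hemp | hne
  · have h22 : 2 ≤ (link G C D A B).encard ∧ 2 ≤ (link G A B C D).encard := by
      have hn : ¬ (A ⊆ D ∧ C ⊆ B) := fun h => hcross (Or.inr (Or.inl h))
      have hnot : ∀ z ∈ A \ B, z ∉ C \ D := fun z hz hz' =>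
        (hemp ▸ (⟨hz, hz'⟩ : z ∈ corner A B C D) : z ∈ (∅ : Set V))
      have kAB : ∀ z, z ∈ A ∪ B := fun z => hAB.1.1 ▸ mem_univ z
      have kCD : ∀ z, z ∈ C ∪ D := fun z => hCD.1.1 ▸ mem_univ z
      rw [not_and_or, not_subset, not_subset] at hn
      rcases hn with ⟨z, hz, hzD⟩ | ⟨z, hz, hzB⟩
      · have hzC := (kCD z).resolve_right hzD
        have hzB : z ∈ B := by
          by_contra h
          exact hnot z ⟨hz, h⟩ ⟨hzC, hzD⟩
        exact (two_le_encard_link hCD hAB ((corner_comm A B C D).trans hemp)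
          (inl_mem_link.2 ⟨⟨hzC, hzD⟩, hz, hzB⟩)).symm
      · have hzA := (kAB z).resolve_right hzB
        have hzD : z ∈ D := by
          by_contra h
          exact hnot z ⟨hzA, hzB⟩ ⟨hz, h⟩
        exact two_le_encard_link hAB hCD hemp (inl_mem_link.2 ⟨⟨hzA, hzB⟩, hz, hzD⟩)
    calc (4 : ℕ∞) = 2 + 2 := by norm_num
      _ ≤ (link G C D A B).encard + (link G A B C D).encard := add_le_add h22.1 h22.2
      _ = (link G C D A B ∪ link G A B C D).encard :=
        (encard_union_eq (disjoint_link_link G A B C D)).symm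
      _ ≤ _ := encard_le_encard fun x hx => Or.inl (Or.inl hx)
  · calc (4 : ℕ∞) ≤ sepOrder G (A ∩ C) (B ∪ D) :=
        hG.le_sepOrder (isMixedSep_corner hAB.1 hCD.1.1 hne)
      _ = _ := (encard_sepElems _ _ _).symm
      _ ≤ _ := encard_le_encard (sepElems_subset_cornerSep hAB.1.1 hCD.1.1)

/-- The diagonal edges with an endvertex in the corner for `AC`. -/
def diagonalsAt (G : SimpleGraph V) (A B C D : Set V) : Set (Sym2 V) :=
  {e | IsDiagonal G A B C D e ∧ ∃ v : V, v ∈ e ∧ v ∈ corner A B C D}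

/-- The edges of `S(A,B)` with both endvertices in `S(C,D)`. -/
def jumpingEdges (G : SimpleGraph V) (A B C D : Set V) : Set (Sym2 V) :=
  {e | e ∈ sepEdges G A B ∧ ∀ v ∈ e, v ∈ C ∩ D}

lemma mem_diagonalsAt_iff {e : Sym2 V} : e ∈ diagonalsAt G A B C D ↔
    e ∈ G.edgeSet ∧ ∃ a b, e = s(a, b) ∧ a ∈ corner A B C D ∧ b ∈ corner B A D C := by
  constructor
  · rintro ⟨⟨he, a, b, rfl, h | h⟩, v, hv, hvc⟩
    · exact ⟨he, a, b, rfl, h⟩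
    · rcases Sym2.mem_iff.1 hv with rfl | rfl
      · exact absurd hvc.2.1 h.1.2.2
      · exact absurd hvc.1.1 h.2.1.2
  · rintro ⟨he, a, b, rfl, h⟩
    exact ⟨⟨he, a, b, rfl, Or.inl h⟩, a, Sym2.mem_mk_left _ _, h.1⟩

lemma diagonalsAt_opposite (G : SimpleGraph V) (A B C D : Set V) :
    diagonalsAt G B A D C = diagonalsAt G A B C D := by
  ext e
  rw [mem_diagonalsAt_iff, mem_diagonalsAt_iff]
  constructor <;> rintro ⟨he, a, b, rfl, h⟩ <;> exact ⟨he, b, a, Sym2.eq_swap, h.symm⟩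

lemma diagonalsAt_comm (G : SimpleGraph V) (A B C D : Set V) :
    diagonalsAt G C D A B = diagonalsAt G A B C D := by
  ext e
  rw [mem_diagonalsAt_iff, mem_diagonalsAt_iff, corner_comm A B C D, corner_comm B A D C]

lemma encard_cornerSep_le (G : SimpleGraph V) (A B C D : Set V) :
    (cornerSep G A B C D).encard ≤ (link G C D A B).encard + (link G A B C D).encard +
      (vertexCentre A B C D).encard + (diagonalsAt G A B C D).encard := by
  unfold cornerSep
  refine (encard_union_le _ _).trans (add_le_add ?_ (encard_image_le _ _))
  refine (encard_union_le _ _).trans (add_le_add ?_ (encard_image_le _ _))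
  exact encard_union_le _ _

lemma encard_links_add_le (hCD : C ∪ D = univ) :
    (link G A B C D).encard + (link G A B D C).encard + (vertexCentre A B C D).encard +
      (diagonalsAt G A B C D).encard + (diagonalsAt G A B D C).encard +
      (jumpingEdges G A B C D).encard ≤ sepOrder G A B := by
  have hDC : D ∪ C = univ := by rw [union_comm, hCD]
  have diag₁ : ∀ e ∈ diagonalsAt G A B C D, ∃ x y, e = s(x, y) ∧ G.Adj x y ∧ x ∈ A \ B ∧
      y ∈ B \ A ∧ x ∈ C \ D ∧ y ∈ D \ C := by
    intro e he
    obtain ⟨hadj, x, y, rfl, hx, hy⟩ := mem_diagonalsAt_iff.1 he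
    exact ⟨x, y, rfl, hadj, hx.1, hy.1, hx.2, hy.2⟩
  have diag₂ : ∀ e ∈ diagonalsAt G A B D C, ∃ x y, e = s(x, y) ∧ G.Adj x y ∧ x ∈ A \ B ∧
      y ∈ B \ A ∧ x ∈ D \ C ∧ y ∈ C \ D := by
    intro e he
    obtain ⟨hadj, x, y, rfl, hx, hy⟩ := mem_diagonalsAt_iff.1 he
    exact ⟨x, y, rfl, hadj, hx.1, hy.1, hx.2, hy.2⟩
  have jump : ∀ e ∈ jumpingEdges G A B C D, ∃ x y, e = s(x, y) ∧ G.Adj x y ∧ x ∈ A \ B ∧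
      y ∈ B \ A ∧ x ∈ C ∩ D ∧ y ∈ C ∩ D := by
    rintro _ ⟨⟨hadj, x, y, rfl, hx, hy⟩, h⟩
    exact ⟨x, y, rfl, hadj, hx, hy, h x (Sym2.mem_mk_left _ _), h y (Sym2.mem_mk_right _ _)⟩
  have link₁ := fun e => exists_of_inr_mem_link (G := G) (A := A) (B := B) (e := e) hCD
  have link₂ := fun e => exists_of_inr_mem_link (G := G) (A := A) (B := B) (e := e) hDC
  have uniq : ∀ {x y x' y' : V}, s(x, y) = s(x', y') → x ∈ A \ B → y' ∈ B \ A →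
      x = x' ∧ y = y' := by
    intro x y x' y' h hx hy
    rcases Sym2.eq_iff.1 h with h | ⟨rfl, -⟩
    · exact h
    · exact absurd hx.1 hy.2
  have h₁ : Disjoint (link G A B C D) (link G A B D C) := by
    rw [disjoint_left]
    rintro (v | e) h1 h2
    · exact (inl_mem_link.1 h1).1.2 (inl_mem_link.1 h2).1.1
    · obtain ⟨x, y, rfl, -, hx, hy, hxC, hyC, hD⟩ := link₁ _ h1
      obtain ⟨x', y', h, -, hx', hy', hxD, hyD, hC⟩ := link₂ _ h2
      obtain ⟨rfl, rfl⟩ := uniq h hx hy'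
      exact hC.elim (absurd hxC) (absurd hyC)
  have h₂ : Disjoint (link G A B C D ∪ link G A B D C) (Sum.inl '' vertexCentre A B C D) := by
    rw [disjoint_left]
    rintro _ h ⟨v, hv, rfl⟩
    rcases h with h | h
    · exact (inl_mem_link.1 h).1.2 hv.2
    · exact (inl_mem_link.1 h).1.2 hv.1.2
  have h₃ : Disjoint (link G A B C D ∪ link G A B D C ∪ Sum.inl '' vertexCentre A B C D)
      (Sum.inr '' diagonalsAt G A B C D) := by
    rw [disjoint_left]
    rintro _ h ⟨e, he, rfl⟩
    rcases h with (h | h) | ⟨_, -, h⟩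
    · exact (inr_mem_link.1 h).2.1 he.1
    · exact (inr_mem_link.1 h).2.1 (isDiagonal_swap_right.2 he.1)
    · cases h
  have h₄ : Disjoint (link G A B C D ∪ link G A B D C ∪ Sum.inl '' vertexCentre A B C D ∪
      Sum.inr '' diagonalsAt G A B C D) (Sum.inr '' diagonalsAt G A B D C) := by
    rw [disjoint_left]
    rintro _ h ⟨e, he, rfl⟩
    rcases h with ((h | h) | ⟨_, -, h⟩) | ⟨e', h, he'⟩
    · exact (inr_mem_link.1 h).2.1 (isDiagonal_swap_right.2 he.1)
    · exact (inr_mem_link.1 h).2.1 he.1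
    · cases h
    · cases he'
      obtain ⟨x, y, rfl, -, hx, hy, hxC, hyD⟩ := diag₁ _ h
      obtain ⟨x', y', h, -, hx', hy', hxD, hyC⟩ := diag₂ _ he
      obtain ⟨rfl, rfl⟩ := uniq h hx hy'
      exact hxD.2 hxC.1
  have h₅ : Disjoint (link G A B C D ∪ link G A B D C ∪ Sum.inl '' vertexCentre A B C D ∪
      Sum.inr '' diagonalsAt G A B C D ∪ Sum.inr '' diagonalsAt G A B D C)
      (Sum.inr '' jumpingEdges G A B C D) := by
    rw [disjoint_left]
    rintro _ h ⟨e, he, rfl⟩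
    rcases h with (((h | h) | ⟨_, -, h⟩) | ⟨e', h, he'⟩) | ⟨e', h, he'⟩
    · obtain ⟨-, -, v, hv, h | h⟩ := inr_mem_link.1 h
      · exact h.2.2 (he.2 v hv).2
      · exact h.2.2 (he.2 v hv).2
    · obtain ⟨-, -, v, hv, h | h⟩ := inr_mem_link.1 h
      · exact h.2.2 (he.2 v hv).1
      · exact h.2.2 (he.2 v hv).1
    · cases h
    · cases he'
      obtain ⟨-, v, hv, h⟩ := h
      exact h.2.2 (he.2 v hv).2
    · cases he'
      obtain ⟨-, v, hv, h⟩ := h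
      exact h.2.2 (he.2 v hv).1
  rw [← encard_sepElems, ← Sum.inl_injective.encard_image (vertexCentre A B C D),
    ← Sum.inr_injective.encard_image (diagonalsAt G A B C D),
    ← Sum.inr_injective.encard_image (diagonalsAt G A B D C),
    ← Sum.inr_injective.encard_image (jumpingEdges G A B C D),
    ← encard_union_eq h₁, ← encard_union_eq h₂, ← encard_union_eq h₃, ← encard_union_eq h₄,
    ← encard_union_eq h₅]
  apply encard_le_encard
  have hlink : ∀ C D : Set V, link G A B C D ⊆ sepElems G A B := by
    rintro C D (v | e) h
    · exact Or.inl ⟨v, (inl_mem_link.1 h).2, rfl⟩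
    · exact Or.inr ⟨e, (inr_mem_link.1 h).1, rfl⟩
  rintro _ (((((h | h) | ⟨v, hv, rfl⟩) | ⟨e, h, rfl⟩) | ⟨e, h, rfl⟩) | ⟨e, h, rfl⟩)
  · exact hlink _ _ h
  · exact hlink _ _ h
  · exact Or.inl ⟨v, hv.1.1, rfl⟩
  · obtain ⟨x, y, rfl, hadj, hx, hy, -⟩ := diag₁ _ h
    exact Or.inr ⟨_, mk_mem_sepEdges hadj hx hy, rfl⟩
  · obtain ⟨x, y, rfl, hadj, hx, hy, -⟩ := diag₂ _ h
    exact Or.inr ⟨_, mk_mem_sepEdges hadj hx hy, rfl⟩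
  · exact Or.inr ⟨_, h.1, rfl⟩

lemma vertexCentre_comm (A B C D : Set V) : vertexCentre C D A B = vertexCentre A B C D := by
  ext; simp only [vertexCentre, mem_inter_iff]; tauto

lemma vertexCentre_swap_left (A B C D : Set V) :
    vertexCentre B A C D = vertexCentre A B C D := by
  rw [vertexCentre, inter_comm B A, vertexCentre]

lemma vertexCentre_swap_right (A B C D : Set V) :
    vertexCentre A B D C = vertexCentre A B C D := by
  ext; simp only [vertexCentre, mem_inter_iff]; tauto

/-- The numerical core of the crossing lemma. -/
lemma link_sizes (hG : KConnected G 4) (hAB : IsTetraSep G A B) (hCD : IsTetraSep G C D)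
    (hcross : Crosses A B C D) :
    diagonalsAt G A B C D = ∅ ∧ diagonalsAt G A B D C = ∅ ∧
      jumpingEdges G A B C D = ∅ ∧ jumpingEdges G C D A B = ∅ ∧
      ∃ n ≤ 2, (link G C D A B).encard = (n : ℕ) ∧ (link G C D B A).encard = (n : ℕ) ∧
        (link G A B C D).encard = (n : ℕ) ∧ (link G A B D C).encard = (n : ℕ) ∧
        (vertexCentre A B C D).encard = ((4 - 2 * n : ℕ) : ℕ∞) := by
  have s1 := encard_links_add_le (G := G) (A := A) (B := B) hCD.1.1
  have s2 := encard_links_add_le (G := G) (A := C) (B := D) hAB.1.1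
  have e1 := (four_le_encard_cornerSep hG hAB hCD hcross).trans (encard_cornerSep_le _ _ _ _ _)
  have e2 := (four_le_encard_cornerSep hG hAB hCD.swap hcross.swap_right).trans
    (encard_cornerSep_le _ _ _ _ _)
  have e3 := (four_le_encard_cornerSep hG hAB.swap hCD hcross.swap_left).trans
    (encard_cornerSep_le _ _ _ _ _)
  have e4 := (four_le_encard_cornerSep hG hAB.swap hCD.swap hcross.swap_left.swap_right).trans
    (encard_cornerSep_le _ _ _ _ _)
  rw [hAB.2.1] at s1
  rw [hCD.2.1, vertexCentre_comm, diagonalsAt_comm G A B C D,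
    diagonalsAt_comm G B A C D, diagonalsAt_opposite G A B D C] at s2
  rw [link_swap G C D A B, vertexCentre_swap_right] at e2
  rw [link_swap G A B C D, vertexCentre_swap_left, diagonalsAt_opposite G A B D C] at e3
  rw [link_swap G C D B A, link_swap G A B D C, vertexCentre_swap_left, vertexCentre_swap_right,
    diagonalsAt_opposite G A B C D] at e4
  rw [← encard_eq_zero, ← encard_eq_zero, ← encard_eq_zero, ← encard_eq_zero]
  generalize (link G C D A B).encard = a at *
  generalize (link G C D B A).encard = b at *
  generalize (link G A B C D).encard = c at *
  generalize (link G A B D C).encard = d at *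
  generalize (vertexCentre A B C D).encard = z at *
  generalize (diagonalsAt G A B C D).encard = g at *
  generalize (diagonalsAt G A B D C).encard = g' at *
  generalize (jumpingEdges G A B C D).encard = j at *
  generalize (jumpingEdges G C D A B).encard = j' at *
  have t1 := ne_top_of_le_ne_top (ENat.natCast_ne_top 4) s1
  have t2 := ne_top_of_le_ne_top (ENat.natCast_ne_top 4) s2
  simp only [ne_eq, ENat.add_eq_top, not_or] at t1 t2
  obtain ⟨⟨⟨⟨⟨hc, hd⟩, hz⟩, hg⟩, hg'⟩, hj⟩ := t1
  obtain ⟨⟨⟨⟨⟨ha, hb⟩, -⟩, -⟩, -⟩, hj'⟩ := t2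
  lift a to ℕ using ha
  lift b to ℕ using hb
  lift c to ℕ using hc
  lift d to ℕ using hd
  lift z to ℕ using hz
  lift g to ℕ using hg
  lift g' to ℕ using hg'
  lift j to ℕ using hj
  lift j' to ℕ using hj'
  norm_cast at *
  refine ⟨by omega, by omega, by omega, by omega, a, by omega, rfl, by omega, by omega, by omega,
    by omega⟩

/-- If an edge dangles from the `A`-link through the `C`-link and the corner-separator at `AC`
has size at most four, then the corner for `AC` is empty. -/
lemma corner_eq_empty_of_dangles (hG : KConnected G 4) (hAB : IsMixedSep A B)
    (hCD : C ∪ D = univ) (hle : (cornerSep G A B C D).encard ≤ 4) {e : Sym2 V}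
    (he : DanglesFromThrough G (link G C D A B) (link G A B C D) e) :
    corner A B C D = ∅ := by
  by_contra hne
  have h4 : 4 ≤ (sepElems G (A ∩ C) (B ∪ D)).encard := by
    rw [encard_sepElems]
    exact hG.le_sepOrder (isMixedSep_corner hAB hCD (nonempty_iff_ne_empty.2 hne))
  have hfin : (cornerSep G A B C D).Finite :=
    finite_of_encard_le_coe (k := 4) hle
  have hsub := sepElems_subset_cornerSep (G := G) hAB.1 hCD
  have heq := (hfin.subset hsub).eq_of_subset_of_encard_le hsub (hle.trans h4)
  obtain ⟨-, ⟨v, hve, hv⟩, hel⟩ := he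
  have hmem : Sum.inr e ∈ sepElems G (A ∩ C) (B ∪ D) := heq ▸ Or.inl (Or.inl (Or.inr hel))
  obtain ⟨x, y, rfl, -, hx, hy, hxC, hyC, -⟩ := exists_of_inr_mem_link hCD hel
  obtain ⟨⟨hvA, hvB⟩, hvC, hvD⟩ := inl_mem_link.1 hv
  rcases hmem with ⟨_, -, h⟩ | ⟨_, ⟨-, x', y', h', hx', hy'⟩, h⟩
  · cases h
  · cases h
    have hxD : x ∈ D := by
      rcases Sym2.mem_iff.1 hve with rfl | rfl
      · exact hvD
      · exact absurd hy.1 hvB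
    rcases Sym2.eq_iff.1 h' with ⟨rfl, rfl⟩ | ⟨rfl, rfl⟩
    · exact hx'.2 (Or.inr hxD)
    · exact hy.2 hx'.1.1

/-- An edge dangling from the `A`-link through the `C`-link makes the corner for `AC` potter. -/
lemma potter_of_dangles (hG : KConnected G 4) (hAB : IsTetraSep G A B) (hCD : IsTetraSep G C D)
    (hcross : Crosses A B C D) {e : Sym2 V}
    (he : DanglesFromThrough G (link G C D A B) (link G A B C D) e) :
    Potter G A B C D := by
  obtain ⟨hg, -, -, -, n, hn, ha, -, hc, -, hz⟩ := link_sizes hG hAB hCD hcross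
  have hle := encard_cornerSep_le G A B C D
  rw [ha, hc, hz, hg, encard_empty] at hle
  have hle4 : (cornerSep G A B C D).encard ≤ 4 := by
    refine hle.trans ?_
    norm_cast
    omega
  have hemp := corner_eq_empty_of_dangles hG hAB.1 hCD.1.1 hle4 he
  obtain ⟨-, ⟨v, hve, hv⟩, hel⟩ := he
  have h2 := (two_le_encard_link hAB hCD hemp hv).1
  have hn2 : n = 2 := by
    rw [ha] at h2
    norm_cast at h2
    omega
  subst hn2
  obtain ⟨x, w, rfl, hadj, hx, hw, hxC, hwC, hD⟩ := exists_of_inr_mem_link hCD.1.1 hel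
  obtain ⟨hvA, hvC⟩ := inl_mem_link.1 hv
  obtain rfl : v = x := by
    rcases Sym2.mem_iff.1 hve with rfl | rfl
    · rfl
    · exact absurd hw.1 hvA.2
  have hwD : w ∉ D := hD.resolve_left (not_not.2 hvC.2)
  obtain ⟨u, -, -, hvu, -, hu, -⟩ := exists_adj_of_corner_eq_empty hAB hCD hemp hv
  have hlink : ∀ p ∈ link G A B C D, p = Sum.inl u ∨ p = Sum.inr s(v, w) := by
    have hfin : (link G A B C D).Finite := finite_of_encard_le_coe (k := 2) hc.le
    have hsub : {Sum.inl u, Sum.inr s(v, w)} ⊆ link G A B C D := by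
      rintro _ (rfl | rfl)
      · exact hu
      · exact hel
    have := (hfin.subset hsub).eq_of_subset_of_encard_le hsub (by rw [hc, encard_pair Sum.inl_ne_inr]; rfl)
    intro p hp
    rw [← this] at hp
    exact hp
  obtain ⟨t, t', htt, hut, hut', ht, ht'⟩ :=
    exists_adj_of_corner_eq_empty hCD hAB ((corner_comm A B C D).trans hemp) hu
  -- The only neighbour of `u` in the `A`-link is `v`.
  have honly : ∀ s, Sum.inl s ∈ link G C D A B → s = v := by
    intro s hs
    obtain ⟨q, r, hqr, -, hsr, hq, hr⟩ := exists_adj_of_corner_eq_empty hAB hCD hemp hs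
    have hqu : q = u := by simpa using hlink _ hq
    subst hqu
    rcases hr with hr | hr
    · exact absurd (by simpa using (hlink _ hr)) hqr.symm
    · have h : s(s, r) = s(v, w) := by simpa using hlink _ hr
      rcases Sym2.eq_iff.1 h with ⟨h, -⟩ | ⟨rfl, -⟩
      · exact h
      · exact absurd hw.1 (inl_mem_link.1 hs).1.2
  obtain rfl := honly t ht
  have ht'' : Sum.inr s(u, t') ∈ link G C D A B := by
    rcases ht' with h | h
    · exact absurd (honly t' h).symm htt
    · exact h
  obtain ⟨huC, huA⟩ := inl_mem_link.1 hu
  have htA : t' ∈ A \ B ∧ t' ∈ D \ C := by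
    obtain ⟨x, y, h, -, hx, hy, hxA, hyA, hB⟩ := exists_of_inr_mem_link hAB.1.1 ht''
    rcases Sym2.eq_iff.1 h with ⟨rfl, rfl⟩ | ⟨rfl, rfl⟩
    · exact ⟨⟨hyA, hB.resolve_left (not_not.2 huA.2)⟩, hy⟩
    · exact absurd hy.1 huC.2
  refine ⟨hemp, ha, hc, t', u, t, w, hut'.symm, hut, hadj, ?_, hu, ?_, hv, hel⟩
  · simp only [List.nodup_cons, List.mem_cons, List.not_mem_nil, or_false, not_or, not_false_eq_true,
      List.nodup_nil, and_true]
    refine ⟨⟨hut'.ne', htt.symm, ?_⟩, ⟨hut.ne, ?_⟩, hadj.ne⟩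
    · rintro rfl
      exact hw.2 htA.1.1
    · rintro rfl
      exact hw.2 huA.1
  · rwa [Sym2.eq_swap]

lemma Potter.comm (h : Potter G C D A B) : Potter G A B C D := by
  obtain ⟨h1, h2, h3, u₁, u₂, u₃, u₄, h12, h23, h34, hnd, m1, m2, m3, m4⟩ := h
  refine ⟨(corner_comm C D A B).trans h1, h3, h2, u₄, u₃, u₂, u₁, h34.symm, h23.symm, h12.symm,
    List.nodup_reverse.2 hnd, m3, ?_, m1, ?_⟩
  · rwa [Sym2.eq_swap]
  · rwa [Sym2.eq_swap]

lemma Crosses.comm (h : Crosses A B C D) : Crosses C D A B := by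
  unfold Crosses Nested LeSep at *; tauto

/-- A dangling edge between the `A`-link and the `C`-link makes the corner for `AC` potter. -/
lemma potter_of_dangles_or (hG : KConnected G 4) (hAB : IsTetraSep G A B)
    (hCD : IsTetraSep G C D) (hcross : Crosses A B C D) {e : Sym2 V}
    (he : DanglesFromThrough G (link G A B C D) (link G C D A B) e ∨
      DanglesFromThrough G (link G C D A B) (link G A B C D) e) :
    Potter G A B C D := by
  rcases he with he | he
  · exact (potter_of_dangles hG hCD hAB hcross.comm he).comm
  · exact potter_of_dangles hG hAB hCD hcross he

/-- the Crossing Lemma. -/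
theorem crossing_lemma (G : SimpleGraph V) (A B C D : Set V) (hG : KConnected G 4)
    (hAB : IsTetraSep G A B) (hCD : IsTetraSep G C D) (hcross : Crosses A B C D) :
    ((link G C D A B = ∅ ∧ link G C D B A = ∅ ∧
        link G A B C D = ∅ ∧ link G A B D C = ∅ ∧
        (centre G A B C D).encard = 4) ∨
      ((link G C D A B).encard = 1 ∧ (link G C D B A).encard = 1 ∧
        (link G A B C D).encard = 1 ∧ (link G A B D C).encard = 1 ∧
        (centre G A B C D).encard = 2) ∨
      LinksTwoCentreEmpty G A B C D) ∧
    (∀ e : Sym2 V, ¬ IsDiagonal G A B C D e) ∧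
    (∀ e : Sym2 V, ¬ IsJumping G A B C D e) ∧
    (∀ e : Sym2 V,
      (DanglesFromThrough G (link G A B C D) (link G C D A B) e ∨
          DanglesFromThrough G (link G C D A B) (link G A B C D) e →
        LinksTwoCentreEmpty G A B C D ∧ Potter G A B C D) ∧
      (DanglesFromThrough G (link G A B D C) (link G C D A B) e ∨
          DanglesFromThrough G (link G C D A B) (link G A B D C) e →
        LinksTwoCentreEmpty G A B C D ∧ Potter G A B D C) ∧
      (DanglesFromThrough G (link G A B C D) (link G C D B A) e ∨
          DanglesFromThrough G (link G C D B A) (link G A B C D) e →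
        LinksTwoCentreEmpty G A B C D ∧ Potter G B A C D) ∧
      (DanglesFromThrough G (link G A B D C) (link G C D B A) e ∨
          DanglesFromThrough G (link G C D B A) (link G A B D C) e →
        LinksTwoCentreEmpty G A B C D ∧ Potter G B A D C)) := by
  obtain ⟨hg, hg', hj, hj', n, hn, ha, hb, hc, hd, hz⟩ := link_sizes hG hAB hCD hcross
  have hdiag : ∀ e : Sym2 V, ¬ IsDiagonal G A B C D e := by
    rintro e ⟨he, a, b, rfl, h | h⟩
    · exact (hg ▸ mem_diagonalsAt_iff.2 ⟨he, a, b, rfl, h⟩ : s(a, b) ∈ (∅ : Set (Sym2 V)))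
    · exact (hg' ▸ mem_diagonalsAt_iff.2 ⟨he, a, b, rfl, h⟩ : s(a, b) ∈ (∅ : Set (Sym2 V)))
  have hcentre : centre G A B C D = Sum.inl '' vertexCentre A B C D := by
    simp [centre, hdiag]
  have hcz : (centre G A B C D).encard = ((4 - 2 * n : ℕ) : ℕ∞) := by
    rw [hcentre, Sum.inl_injective.encard_image, hz]
  have hjump : ∀ {A B C D : Set V}, jumpingEdges G A B C D = ∅ → ∀ {a b : V}, G.Adj a b →
      Sum.inl a ∈ link G C D A B → Sum.inl b ∈ link G C D B A → False := by
    intro A B C D hj a b hab ha hb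
    rw [inl_mem_link] at ha hb
    have : s(a, b) ∈ jumpingEdges G A B C D := by
      refine ⟨mk_mem_sepEdges hab ha.1 hb.1, fun v hv => ?_⟩
      rcases Sym2.mem_iff.1 hv with rfl | rfl
      · exact ha.2
      · exact hb.2
    exact (hj ▸ this : s(a, b) ∈ (∅ : Set (Sym2 V)))
  have hlinks : (link G C D A B).encard = 2 → LinksTwoCentreEmpty G A B C D := by
    intro h
    have hn2 : n = 2 := by
      rw [ha] at h
      exact_mod_cast h
    subst hn2
    exact ⟨ha, hb, hc, hd, encard_eq_zero.1 hcz⟩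
  refine ⟨?_, hdiag, ?_, fun e => ⟨fun h => ?_, fun h => ?_, fun h => ?_, fun h => ?_⟩⟩
  · interval_cases n
    · exact Or.inl ⟨encard_eq_zero.1 ha, encard_eq_zero.1 hb, encard_eq_zero.1 hc,
        encard_eq_zero.1 hd, hcz⟩
    · exact Or.inr (Or.inl ⟨ha, hb, hc, hd, hcz⟩)
    · exact Or.inr (Or.inr (hlinks ha))
  · rintro e ⟨he, a, b, rfl, h | h⟩
    · exact hjump hj he h.1 h.2
    · exact hjump hj' he h.1 h.2
  · have hp := potter_of_dangles_or hG hAB hCD hcross h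
    exact ⟨hlinks hp.2.1, hp⟩
  · rw [← link_swap G C D A B] at h
    have hp := potter_of_dangles_or hG hAB hCD.swap hcross.swap_right h
    exact ⟨hlinks (link_swap G C D A B ▸ hp.2.1), hp⟩
  · rw [← link_swap G A B C D] at h
    have hp := potter_of_dangles_or hG hAB.swap hCD hcross.swap_left h
    exact ⟨hlinks (ha.trans (hb.symm.trans hp.2.1)), hp⟩
  · rw [← link_swap G A B D C, ← link_swap G C D B A] at h
    have hp := potter_of_dangles_or hG hAB.swap hCD.swap hcross.swap_left.swap_right h
    exact ⟨hlinks (ha.trans (hb.symm.trans (link_swap G C D B A ▸ hp.2.1))), hp⟩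
end Paper
end
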